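/- Let q be a power of an odd prime, let f₁ ≠ f₂ be distinct monic squarefree cubic polynomials in 𝔽_q[x], let K = 𝔽_q(x), and let y₁, y₂ lie in a fixed algebraic closure of K with y_i² = f_i(x). Let c₀, c₁, c₂, c₃ ∈ K and set g = c₀ + c₁y₁ + c₂y₂ + c₃y₁y₂. If g² = f₃ for some cubic polynomial f₃ ∈ 𝔽_q[x], then c₃ = 0. -/

import Mathlib

open Polynomial

/-- A square root of a nonsquare generates a quadratic extension. -/
theorem eq_zero_of_add_mul_sqrt_eq_zero {K L : Type*} [Field K] [Field L] [Algebra K L]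
    {a : K} (ha : ¬ IsSquare a) {y : L} (hy : y ^ 2 = algebraMap K L a) {p q : K}
    (h : algebraMap K L p + algebraMap K L q * y = 0) : p = 0 ∧ q = 0 := by
  have hq : q = 0 := by
    by_contra hq
    refine ha ⟨p / q, (algebraMap K L).injective ?_⟩
    have hq' : algebraMap K L q ≠ 0 := by simpa using hq
    rw [← hy, map_mul, map_div₀]
    field_simp
    linear_combination (algebraMap K L q * y - algebraMap K L p) * h
  subst hq
  simpa using h

/-- If `a`, `b` and `a * b` are nonsquares, then `1, √a, √b, √a√b` are linearly independent. -/
theorem eq_zero_of_biquadratic_eq_zero {K L : Type*} [Field K] [Field L] [Algebra K L]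
    (h2 : (2 : K) ≠ 0) {a b : K} (ha : ¬ IsSquare a) (hb : ¬ IsSquare b) (hab : ¬ IsSquare (a * b))
    {y z : L} (hy : y ^ 2 = algebraMap K L a) (hz : z ^ 2 = algebraMap K L b) {p q r s : K}
    (h : algebraMap K L p + algebraMap K L q * y + algebraMap K L r * z +
      algebraMap K L s * (y * z) = 0) : p = 0 ∧ q = 0 ∧ r = 0 ∧ s = 0 := by
  by_cases hN : r ^ 2 - s ^ 2 * a = 0
  · have hs : s = 0 := by
      by_contra hs
      refine ha ⟨r / s, ?_⟩
      field_simp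
      linear_combination -hN
    subst hs
    have hr : r = 0 := by simpa using hN
    subst hr
    obtain ⟨hp, hq⟩ := eq_zero_of_add_mul_sqrt_eq_zero ha hy (p := p) (q := q) (by simpa using h)
    exact ⟨hp, hq, rfl, rfl⟩
  · exfalso
    set N := r ^ 2 - s ^ 2 * a with hNdef
    have hNmap : algebraMap K L N =
        algebraMap K L r ^ 2 - algebraMap K L s ^ 2 * algebraMap K L a := by simp [hNdef]
    set u := q * s * a - p * r with hu
    set v := p * s - q * r with hv
    have hlin : algebraMap K L N * z = algebraMap K L u + algebraMap K L v * y := by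
      rw [hNmap, hu, hv]
      simp only [map_sub, map_mul]
      linear_combination (algebraMap K L r - algebraMap K L s * y) * h +
        (algebraMap K L s * algebraMap K L q + algebraMap K L s ^ 2 * z) * hy
    have hsq : algebraMap K L (u ^ 2 + v ^ 2 * a - N ^ 2 * b) +
        algebraMap K L (2 * u * v) * y = 0 := by
      simp only [map_sub, map_mul, map_add, map_pow, map_ofNat]
      rw [← hy, ← hz]
      linear_combination -(algebraMap K L N * z + algebraMap K L u + algebraMap K L v * y) * hlin
    obtain ⟨h0, h1⟩ := eq_zero_of_add_mul_sqrt_eq_zero ha hy hsq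
    have huv : u = 0 ∨ v = 0 := by simpa [h2] using h1
    rcases huv with hu0 | hv0
    · refine hab ⟨v * a / N, ?_⟩
      rw [hu0] at h0
      field_simp
      linear_combination -a * h0
    · refine hb ⟨u / N, ?_⟩
      rw [hv0] at h0
      field_simp
      linear_combination -h0

/-- A rational function of odd degree is not a square. -/
theorem RatFunc.not_isSquare_of_odd_intDegree {F : Type*} [Field F] {f : RatFunc F}
    (hf : Odd f.intDegree) : ¬ IsSquare f := by
  rintro ⟨c, rfl⟩
  rcases eq_or_ne c 0 with rfl | hc
  · simp at hf
  · rw [RatFunc.intDegree_mul hc hc] at hf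
    exact (Int.not_odd_iff_even.mpr ⟨_, rfl⟩) hf

/-- If the product of two monic squarefree polynomials of the same degree is the square of a
rational function, then the two polynomials agree. -/
theorem Polynomial.eq_of_isSquare_mul_of_squarefree {F : Type*} [Field F] {f g : F[X]}
    (hf : f.Monic) (hg : g.Monic) (hsf : Squarefree f) (hdeg : g.natDegree ≤ f.natDegree)
    (h : IsSquare (algebraMap F[X] (RatFunc F) f * algebraMap F[X] (RatFunc F) g)) : g = f := by
  obtain ⟨c, hc⟩ := h
  have hint : IsIntegral F[X] (c ^ 2) := by
    rw [sq, ← hc, ← map_mul]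
    exact isIntegral_algebraMap
  obtain ⟨k, rfl⟩ := IsIntegrallyClosed.exists_algebraMap_eq_of_isIntegral_pow two_pos hint
  have hk : f * g = k * k := by
    apply RatFunc.algebraMap_injective F
    simpa using hc
  have hdvd : f ∣ k := (hsf.dvd_pow_iff_dvd two_ne_zero).mp ⟨g, by rw [hk, sq]⟩
  obtain ⟨m, rfl⟩ := hdvd
  have hgm : g = f * (m * m) := mul_left_cancel₀ hf.ne_zero (by rw [hk]; ring)
  exact Polynomial.eq_of_monic_of_dvd_of_natDegree_le hf hg ⟨_, hgm⟩ hdeg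

/-- for `q` odd and distinct monic squarefree cubics `f₁ ≠ f₂` over `𝔽_q`, with
`K = 𝔽_q(x)` and `y_i² = f_i(x)` in a fixed algebraic closure of `K`, if
`g = c₀ + c₁y₁ + c₂y₂ + c₃y₁y₂` with `c₀, c₁, c₂, c₃ ∈ K` satisfies `g² = f₃` for some cubic
polynomial `f₃ ∈ 𝔽_q[x]`, then `c₃ = 0`. -/
theorem stmt15 (F : Type*) [Field F] [Fintype F] (hodd : Odd (Fintype.card F))
    (f₁ f₂ : Polynomial F) (hne : f₁ ≠ f₂)
    (hmon₁ : f₁.Monic) (hsf₁ : Squarefree f₁) (hdeg₁ : f₁.natDegree = 3)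
    (hmon₂ : f₂.Monic) (hsf₂ : Squarefree f₂) (hdeg₂ : f₂.natDegree = 3)
    (y₁ y₂ : AlgebraicClosure (RatFunc F))
    (hy₁ : y₁ ^ 2 = algebraMap (RatFunc F) (AlgebraicClosure (RatFunc F))
      (algebraMap (Polynomial F) (RatFunc F) f₁))
    (hy₂ : y₂ ^ 2 = algebraMap (RatFunc F) (AlgebraicClosure (RatFunc F))
      (algebraMap (Polynomial F) (RatFunc F) f₂))
    (c₀ c₁ c₂ c₃ : RatFunc F)
    (f₃ : Polynomial F) (hdeg₃ : f₃.natDegree = 3)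
    (hg : (algebraMap (RatFunc F) (AlgebraicClosure (RatFunc F)) c₀ +
        algebraMap (RatFunc F) (AlgebraicClosure (RatFunc F)) c₁ * y₁ +
        algebraMap (RatFunc F) (AlgebraicClosure (RatFunc F)) c₂ * y₂ +
        algebraMap (RatFunc F) (AlgebraicClosure (RatFunc F)) c₃ * (y₁ * y₂)) ^ 2 =
      algebraMap (RatFunc F) (AlgebraicClosure (RatFunc F))
        (algebraMap (Polynomial F) (RatFunc F) f₃)) :
    c₃ = 0 := by
  have h2 : (2 : RatFunc F) ≠ 0 := by
    have h2F : (2 : F) ≠ 0 := Ring.two_ne_zero fun h =>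
      (Nat.not_even_iff_odd.mpr hodd) (Nat.even_iff.mpr (FiniteField.even_card_of_char_two h))
    rw [← map_ofNat (algebraMap F (RatFunc F)) 2]
    exact (_root_.map_ne_zero _).mpr h2F
  have hns : ∀ f : F[X], f.natDegree = 3 → ¬ IsSquare (algebraMap F[X] (RatFunc F) f) := by
    intro f hf
    apply RatFunc.not_isSquare_of_odd_intDegree
    rw [RatFunc.intDegree_polynomial, hf]
    decide
  have hns₁ := hns f₁ hdeg₁
  have hns₂ := hns f₂ hdeg₂
  have hns₁₂ : ¬ IsSquare (algebraMap F[X] (RatFunc F) f₁ * algebraMap F[X] (RatFunc F) f₂) :=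
    fun h => hne (Polynomial.eq_of_isSquare_mul_of_squarefree hmon₁ hmon₂ hsf₁
      (by rw [hdeg₁, hdeg₂]) h).symm
  have hodd₁₂₃ : Odd (algebraMap F[X] (RatFunc F) (f₁ * f₂ * f₃)).intDegree := by
    have h0 : ∀ f : F[X], f.natDegree = 3 → f ≠ 0 := by
      rintro _ hf rfl
      simp at hf
    rw [RatFunc.intDegree_polynomial, natDegree_mul (mul_ne_zero (h0 _ hdeg₁) (h0 _ hdeg₂))
      (h0 _ hdeg₃), natDegree_mul (h0 _ hdeg₁) (h0 _ hdeg₂), hdeg₁, hdeg₂, hdeg₃]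
    decide
  have hns₁₂₃ := RatFunc.not_isSquare_of_odd_intDegree hodd₁₂₃
  rw [map_mul, map_mul] at hns₁₂₃
  generalize algebraMap F[X] (RatFunc F) f₁ = a at *
  generalize algebraMap F[X] (RatFunc F) f₂ = b at *
  generalize algebraMap F[X] (RatFunc F) f₃ = d at *
  obtain ⟨e₀, e₁, e₂, e₃⟩ := eq_zero_of_biquadratic_eq_zero h2 hns₁ hns₂ hns₁₂ hy₁ hy₂
    (p := c₀ ^ 2 + c₁ ^ 2 * a + c₂ ^ 2 * b + c₃ ^ 2 * (a * b) - d)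
    (q := 2 * (c₀ * c₁ + c₂ * c₃ * b)) (r := 2 * (c₀ * c₂ + c₁ * c₃ * a))
    (s := 2 * (c₀ * c₃ + c₁ * c₂)) (by
      simp only [map_sub, map_mul, map_add, map_pow, map_ofNat]
      rw [← hg, ← hy₁, ← hy₂]
      ring)
  replace e₁ := (mul_eq_zero.mp e₁).resolve_left h2
  replace e₂ := (mul_eq_zero.mp e₂).resolve_left h2
  replace e₃ := (mul_eq_zero.mp e₃).resolve_left h2
  by_contra hc
  have hc₂ : c₂ = 0 := by
    by_contra hc₂
    refine hns₂ ⟨c₁ / c₃, ?_⟩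
    field_simp
    apply mul_left_cancel₀ hc₂
    linear_combination c₃ * e₁ - c₁ * e₃
  subst hc₂
  have hc₁ : c₁ = 0 := by
    have : c₁ * c₃ * a = 0 := by simpa using e₂
    have ha : a ≠ 0 := by
      rintro rfl
      exact hns₁ (IsSquare.zero)
    simpa [hc, ha] using this
  subst hc₁
  have hc₀ : c₀ = 0 := by simpa [hc] using e₃
  subst hc₀
  exact hns₁₂₃ ⟨c₃ * (a * b), by linear_combination -(a * b) * e₀⟩
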